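/- Let ϑ, μ ∈ ℝ and let ψ : [0, ∞) → (0, ∞) be continuous. Then the matrix Riccati initial value problem Γ'(t) = ψ(t)⁻¹ F_{ψ(t)}(Γ(t)), Γ(0) = 0, has a unique solution Γ : [0, ∞) → M₂(ℝ), and Γ(t) is symmetric and positive semidefinite for every t ≥ 0 (in particular the solution does not blow up in finite time). -/

import Mathlib

open Matrix Filter Set MeasureTheory

/-- The column vector `b(ψ) = (1, ψ)ᵀ`. -/
def bVec (ψ : ℝ) : Fin 2 → ℝ := ![1, ψ]

/-- The column vector `ℓ(ψ) = (ψ, 1)ᵀ`. -/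
def lVec (ψ : ℝ) : Fin 2 → ℝ := ![ψ, 1]

/-- The matrix `A(ψ) = b(ψ) ℓ(ψ)ᵀ = [[ψ, 1], [ψ², ψ]]`. -/
noncomputable def Amat (ψ : ℝ) : Matrix (Fin 2) (Fin 2) ℝ := vecMulVec (bVec ψ) (lVec ψ)

/-- The all-ones matrix `J = [[1,1],[1,1]]`. -/
def Jmat : Matrix (Fin 2) (Fin 2) ℝ := !![1, 1; 1, 1]

/-- The Riccati map `F_ψ(X) = -(ϑ/2)(A(ψ)X + X A(ψ)ᵀ) + b bᵀ - (μ²/4) X ℓ ℓᵀ X`. -/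
noncomputable def Fric (ψ ϑ μ : ℝ) (X : Matrix (Fin 2) (Fin 2) ℝ) : Matrix (Fin 2) (Fin 2) ℝ :=
  (-(ϑ / 2)) • (Amat ψ * X + X * (Amat ψ)ᵀ) + vecMulVec (bVec ψ) (bVec ψ)
    - (μ ^ 2 / 4) • (X * vecMulVec (lVec ψ) (lVec ψ) * X)

/-- The autonomous limiting Riccati map `F∞(X) = -(ϑ/2)(JX + XJ) + J - (μ²/4) X J X`. -/
noncomputable def Finf (ϑ μ : ℝ) (X : Matrix (Fin 2) (Fin 2) ℝ) : Matrix (Fin 2) (Fin 2) ℝ :=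
  (-(ϑ / 2)) • (Jmat * X + X * Jmat) + Jmat - (μ ^ 2 / 4) • (X * Jmat * X)

/-- The scaling matrix `Δ(ψ) = diag(ψ^{1/2}, ψ^{-1/2})`. -/
noncomputable def Dscale (ψ : ℝ) : Matrix (Fin 2) (Fin 2) ℝ :=
  Matrix.diagonal ![Real.sqrt ψ, (Real.sqrt ψ)⁻¹]

attribute [local instance] Matrix.normedAddCommGroup Matrix.normedSpace

section GeneralODE

open Metric ODE
open scoped NNReal

variable {E : Type*} [NormedAddCommGroup E] [NormedSpace ℝ E]

/-- A normed space has a `2`-Lipschitz retraction onto each closed ball around the origin. -/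
lemma exists_lipschitzWith_retraction_closedBall {R : ℝ} (hR : 0 < R) :
    ∃ ρ : E → E, LipschitzWith 2 ρ ∧ (∀ x, ‖ρ x‖ ≤ R) ∧ ∀ x, ‖x‖ ≤ R → ρ x = x := by
  have hpos : ∀ x : E, 0 < max R ‖x‖ := fun x => lt_max_of_lt_left hR
  refine ⟨fun x => (R / max R ‖x‖) • x, LipschitzWith.of_dist_le_mul fun x y => ?_,
    fun x => ?_, fun x hx => ?_⟩
  · have hx := hpos x
    have hy := hpos y
    rw [dist_eq_norm, dist_eq_norm]
    have split : (R / max R ‖x‖) • x - (R / max R ‖y‖) • y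
        = (R / max R ‖x‖) • (x - y) + (R / max R ‖x‖ - R / max R ‖y‖) • y := by
      rw [smul_sub, sub_smul]; abel
    have first : ‖(R / max R ‖x‖) • (x - y)‖ ≤ ‖x - y‖ := by
      rw [norm_smul, Real.norm_of_nonneg (by positivity)]
      exact mul_le_of_le_one_left (norm_nonneg _) ((div_le_one hx).2 (le_max_left _ _))
    have second : ‖(R / max R ‖x‖ - R / max R ‖y‖) • y‖ ≤ ‖x - y‖ := by
      have hdiff : R / max R ‖x‖ - R / max R ‖y‖
          = R / max R ‖x‖ * ((max R ‖y‖ - max R ‖x‖) / max R ‖y‖) := by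
        field_simp
      have hmax : |max R ‖y‖ - max R ‖x‖| ≤ ‖x - y‖ := by
        refine (abs_max_sub_max_le_max R ‖y‖ R ‖x‖).trans ?_
        rw [sub_self, abs_zero, max_eq_right (abs_nonneg _), norm_sub_rev]
        exact abs_norm_sub_norm_le y x
      rw [norm_smul, hdiff, Real.norm_eq_abs, abs_mul, abs_div (_ - _),
        abs_of_nonneg (div_nonneg hR.le hx.le), abs_of_pos hy, mul_assoc,
        div_mul_eq_mul_div |_ - _|]
      have hle : |max R ‖y‖ - max R ‖x‖| * ‖y‖ / max R ‖y‖ ≤ ‖x - y‖ := by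
        rw [div_le_iff₀ hy]
        exact mul_le_mul hmax (le_max_right _ _) (norm_nonneg _) (norm_nonneg _)
      exact (mul_le_of_le_one_left (by positivity)
        ((div_le_one hx).2 (le_max_left _ _))).trans hle
    rw [split]
    refine (norm_add_le _ _).trans ?_
    push_cast
    linarith
  · rw [norm_smul, Real.norm_of_nonneg (div_nonneg hR.le (hpos x).le), div_mul_eq_mul_div,
      div_le_iff₀ (hpos x)]
    exact mul_le_mul_of_nonneg_left (le_max_right _ _) hR.le
  · simp only [max_eq_left hx, div_self hR.ne', one_smul]

/-- Uniqueness of integral curves on `[0, T]` for a field that is Lipschitz on balls,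
uniformly in time. -/
lemma IsIntegralCurveOn.eqOn_Icc_of_lipschitzOnWith_closedBall {f : ℝ → E → E} {T : ℝ}
    (hf : ∀ R : ℝ, ∃ K : ℝ≥0, ∀ t ∈ Icc 0 T, LipschitzOnWith K (f t) (closedBall 0 R))
    {x y : ℝ → E} (hx : IsIntegralCurveOn x f (Icc 0 T)) (hy : IsIntegralCurveOn y f (Icc 0 T))
    (h0 : x 0 = y 0) : EqOn x y (Icc 0 T) := by
  obtain ⟨B, hB⟩ := isCompact_Icc.exists_bound_of_continuousOn hx.continuousOn
  obtain ⟨C, hC⟩ := isCompact_Icc.exists_bound_of_continuousOn hy.continuousOn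
  obtain ⟨K, hK⟩ := hf (max B C)
  have right {z : ℝ → E} (hz : IsIntegralCurveOn z f (Icc 0 T)) (t : ℝ) (ht : t ∈ Ico 0 T) :
      HasDerivWithinAt z (f t (z t)) (Ici t) t :=
    (hz t (Ico_subset_Icc_self ht)).mono_of_mem_nhdsWithin (Icc_mem_nhdsGE_of_mem ht)
  refine ODE_solution_unique_of_mem_Icc_right (s := fun _ => closedBall 0 (max B C))
    (fun t ht => hK t (Ico_subset_Icc_self ht)) hx.continuousOn (right hx) (fun t ht => ?_)
    hy.continuousOn (right hy) (fun t ht => ?_) h0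
  · exact mem_closedBall_zero_iff.2 ((hB t (Ico_subset_Icc_self ht)).trans (le_max_left _ _))
  · exact mem_closedBall_zero_iff.2 ((hC t (Ico_subset_Icc_self ht)).trans (le_max_right _ _))

/-- A field that is Lipschitz on balls uniformly in time has an integral curve on `[0, T]` as soon
as its integral curves on shorter intervals obey an a priori bound. -/
lemma exists_isIntegralCurveOn_Icc_of_apriori_bound [CompleteSpace E] {f : ℝ → E → E} {T : ℝ}
    (hT : 0 ≤ T)
    (hf : ∀ R : ℝ, ∃ K : ℝ≥0, ∀ t ∈ Icc 0 T, LipschitzOnWith K (f t) (closedBall 0 R))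
    (hcont : ∀ x, ContinuousOn (f · x) (Icc 0 T)) (x₀ : E) (C : ℝ)
    (hC : ∀ τ ∈ Icc 0 T, ∀ x : ℝ → E, x 0 = x₀ → IsIntegralCurveOn x f (Icc 0 τ) → ‖x τ‖ ≤ C) :
    ∃ x : ℝ → E, x 0 = x₀ ∧ IsIntegralCurveOn x f (Icc 0 T) := by
  set R : ℝ := max (C + 1) 1
  have hR : 0 < R := lt_max_of_lt_right one_pos
  have hCR : C < R := (lt_add_one C).trans_le (le_max_left _ _)
  obtain ⟨ρ, hρ, hρR, hρ_id⟩ := exists_lipschitzWith_retraction_closedBall (E := E) hR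
  obtain ⟨K, hK⟩ := hf R
  obtain ⟨B, hB⟩ := isCompact_Icc.exists_bound_of_continuousOn (hcont 0)
  have hB0 : 0 ≤ B := (norm_nonneg _).trans (hB 0 ⟨le_rfl, hT⟩)
  have hmem (x : E) : ρ x ∈ closedBall (0 : E) R := mem_closedBall_zero_iff.2 (hρR x)
  have hbound : ∀ t ∈ Icc 0 T, ∀ x, ‖f t (ρ x)‖ ≤ B + K * R := by
    intro t ht x
    have h1 := (hK t ht).dist_le_mul (ρ x) (hmem x) 0 (by simp [hR.le])
    rw [dist_eq_norm, dist_zero_right] at h1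
    have h2 := hB t ht
    have h3 : (K : ℝ) * ‖ρ x‖ ≤ K * R := mul_le_mul_of_nonneg_left (hρR x) K.2
    have h4 := norm_le_norm_add_norm_sub' (f t (ρ x)) (f t 0)
    linarith
  have hL0 : 0 ≤ B + K * R := add_nonneg hB0 (mul_nonneg K.2 hR.le)
  have hPL : IsPicardLindelof (fun t x => f t (ρ x)) (⟨0, le_rfl, hT⟩ : Icc 0 T) x₀
      ⟨(B + K * R) * T, mul_nonneg hL0 hT⟩ 0 ⟨B + K * R, hL0⟩ (K * 2) :=
    { lipschitzOnWith := fun t ht =>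
        (hK t ht).comp (hρ.lipschitzOnWith) fun x _ => hmem x
      continuousOn := fun x _ => hcont (ρ x)
      norm_le := fun t ht x _ => hbound t ht x
      mul_max_le := by
        rw [sub_zero, sub_self, max_eq_left hT, NNReal.coe_zero, sub_zero]
        exact le_rfl }
  obtain ⟨x, hx0, hx⟩ := hPL.exists_eq_forall_mem_Icc_hasDerivWithinAt₀
  have hxc : ContinuousOn x (Icc 0 T) := fun t ht => (hx t ht).continuousWithinAt
  have hcurve : ∀ τ ∈ Icc 0 T, (∀ s ∈ Icc 0 τ, ‖x s‖ ≤ R) →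
      IsIntegralCurveOn x f (Icc 0 τ) := by
    intro τ hτ hs t ht
    have := (hx t ⟨ht.1, ht.2.trans hτ.2⟩).mono (Icc_subset_Icc_right hτ.2)
    rwa [hρ_id _ (hs t ht)] at this
  have hx0R : ‖x 0‖ < R := by
    refine (hC 0 ⟨le_rfl, hT⟩ x hx0 fun t ht => ?_).trans_lt hCR
    obtain rfl : t = 0 := le_antisymm ht.2 ht.1
    rw [Icc_self]
    exact HasFDerivWithinAt.singleton
  have hcross : ∀ s ∈ Icc 0 T, R < ‖x s‖ → ∃ u ∈ Icc 0 s, ‖x u‖ = R := fun s hs hRs =>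
    intermediate_value_Icc hs.1 (hxc.norm.mono (Icc_subset_Icc_right hs.2)) ⟨hx0R.le, hRs.le⟩
  have hstay : ∀ s ∈ Icc 0 T, ‖x s‖ ≤ R := by
    by_contra! ⟨s, hs, hRs⟩
    have hcompact : IsCompact (Icc 0 T ∩ {t | ‖x t‖ = R}) :=
      isCompact_Icc.of_isClosed_subset
        (hxc.norm.preimage_isClosed_of_isClosed isClosed_Icc isClosed_singleton) inter_subset_left
    obtain ⟨u, hu, huR⟩ := hcross s hs hRs
    obtain ⟨τ, ⟨hτ, hτR⟩, hleast⟩ :=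
      hcompact.exists_isLeast ⟨u, ⟨hu.1, hu.2.trans hs.2⟩, huR⟩
    refine (hC τ hτ x hx0 (hcurve τ hτ fun r hr => ?_)).not_gt (hCR.trans_eq hτR.symm)
    by_contra! hRr
    have hrT : r ∈ Icc 0 T := ⟨hr.1, hr.2.trans hτ.2⟩
    obtain ⟨v, hv, hvR⟩ := hcross r hrT hRr
    have hτv : τ ≤ v := hleast ⟨⟨hv.1, hv.2.trans hrT.2⟩, hvR⟩
    have hrτ : r = τ := le_antisymm hr.2 (hτv.trans hv.2)
    exact hRr.ne' (hrτ ▸ hτR)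
  exact ⟨x, hx0, hcurve T ⟨hT, le_rfl⟩ hstay⟩

/-- Linear equations with continuous coefficients are solvable on `[0, T]`. -/
lemma exists_isIntegralCurveOn_Icc_linear [CompleteSpace E] {B : ℝ → E →L[ℝ] E} {T : ℝ}
    (hT : 0 ≤ T) (hB : ContinuousOn B (Icc 0 T)) (x₀ : E) :
    ∃ x : ℝ → E, x 0 = x₀ ∧ IsIntegralCurveOn x (fun t x => B t x) (Icc 0 T) := by
  obtain ⟨K, hK⟩ := isCompact_Icc.exists_bound_of_continuousOn hB
  have hK0 : 0 ≤ K := (norm_nonneg _).trans (hK 0 ⟨le_rfl, hT⟩)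
  refine exists_isIntegralCurveOn_Icc_of_apriori_bound hT (fun R => ⟨⟨K, hK0⟩, fun t ht => ?_⟩)
    (fun x => hB.clm_apply continuousOn_const) x₀ (‖x₀‖ * Real.exp (K * T))
    fun τ hτ x hx0 hx => ?_
  · exact ((B t).lipschitz.weaken (hK t ht)).lipschitzOnWith
  · have := norm_le_gronwallBound_of_norm_deriv_right_le (K := K) (ε := 0) hx.continuousOn
      (fun t ht => (hx t (Ico_subset_Icc_self ht)).mono_of_mem_nhdsWithin
        (Icc_mem_nhdsGE_of_mem ht)) le_rfl
      (fun t ht => by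
        rw [add_zero]
        exact (B t).le_of_opNorm_le (hK t ⟨ht.1, ht.2.le.trans hτ.2⟩) (x t)) τ ⟨hτ.1, le_rfl⟩
    rw [gronwallBound_ε0, hx0, sub_zero] at this
    refine this.trans ?_
    gcongr
    exact hτ.2

end GeneralODE

/-- The right-hand side `ψ(t)⁻¹ F_{ψ(t)}(X)` of the Riccati equation in physical time. -/
noncomputable def riccatiField (ψ : ℝ → ℝ) (ϑ μ t : ℝ) (X : Matrix (Fin 2) (Fin 2) ℝ) :
    Matrix (Fin 2) (Fin 2) ℝ :=
  (ψ t)⁻¹ • Fric (ψ t) ϑ μ X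

section Riccati

open Metric
open scoped NNReal

lemma Fric_apply (p ϑ μ : ℝ) (X : Matrix (Fin 2) (Fin 2) ℝ) (i j : Fin 2) :
    Fric p ϑ μ X i j =
      -(ϑ / 2) * (bVec p i * (p * X 0 j + X 1 j) + (p * X i 0 + X i 1) * bVec p j)
        + bVec p i * bVec p j
        - μ ^ 2 / 4 * ((p * X i 0 + X i 1) * (p * X 0 j + X 1 j)) := by
  fin_cases i <;> fin_cases j <;>
    simp [Fric, Amat, bVec, lVec, Matrix.mul_apply, Fin.sum_univ_two] <;> ring

lemma Fric_transpose (p ϑ μ : ℝ) (X : Matrix (Fin 2) (Fin 2) ℝ) :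
    Fric p ϑ μ Xᵀ = (Fric p ϑ μ X)ᵀ := by
  ext i j
  simp only [Fric_apply, transpose_apply]
  ring

lemma contDiff_smul_Fric (ϑ μ : ℝ) :
    ContDiff ℝ 1 fun z : ℝ × ℝ × Matrix (Fin 2) (Fin 2) ℝ => z.2.1 • Fric z.1 ϑ μ z.2.2 := by
  have hentry (i j : Fin 2) :
      ContDiff ℝ 1 fun z : ℝ × ℝ × Matrix (Fin 2) (Fin 2) ℝ => z.2.2 i j :=
    (contDiff_apply_apply ℝ ℝ i j).comp (contDiff_snd.comp contDiff_snd)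
  have hb (i : Fin 2) : ContDiff ℝ 1 fun z : ℝ × ℝ × Matrix (Fin 2) (Fin 2) ℝ => bVec z.1 i := by
    fin_cases i
    · exact contDiff_const
    · exact contDiff_fst
  refine contDiff_pi.2 fun i => contDiff_pi.2 fun j => ?_
  have := hentry 0 j
  have := hentry 1 j
  have := hentry i 0
  have := hentry i 1
  have := hb i
  have := hb j
  simp only [Matrix.smul_apply, Fric_apply, smul_eq_mul]
  fun_prop

variable {ϑ μ T : ℝ} {ψ : ℝ → ℝ}

lemma continuousOn_inv_of_pos (hψ : ContinuousOn ψ (Icc 0 T)) (hpos : ∀ t ∈ Icc 0 T, 0 < ψ t) :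
    ContinuousOn (fun t => (ψ t)⁻¹) (Icc 0 T) :=
  hψ.inv₀ fun t ht => (hpos t ht).ne'

lemma exists_bound_self_inv (hψ : ContinuousOn ψ (Icc 0 T)) (hpos : ∀ t ∈ Icc 0 T, 0 < ψ t) :
    ∃ N : ℝ, 0 ≤ N ∧ ∀ t ∈ Icc 0 T, ψ t ≤ N ∧ (ψ t)⁻¹ ≤ N := by
  obtain ⟨B, hB⟩ := isCompact_Icc.exists_bound_of_continuousOn hψ
  obtain ⟨C, hC⟩ := isCompact_Icc.exists_bound_of_continuousOn (continuousOn_inv_of_pos hψ hpos)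
  refine ⟨max (max B C) 0, le_max_right _ _, fun t ht => ⟨?_, ?_⟩⟩
  · exact ((le_abs_self _).trans (hB t ht)).trans (by simp)
  · exact ((le_abs_self _).trans (hC t ht)).trans (by simp)

lemma riccatiField_lipschitzOnWith (hψ : ContinuousOn ψ (Icc 0 T))
    (hpos : ∀ t ∈ Icc 0 T, 0 < ψ t) (R : ℝ) :
    ∃ K : ℝ≥0, ∀ t ∈ Icc 0 T, LipschitzOnWith K (riccatiField ψ ϑ μ t) (closedBall 0 R) := by
  obtain ⟨N, -, hN⟩ := exists_bound_self_inv hψ hpos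
  obtain ⟨K, hK⟩ := (contDiff_smul_Fric ϑ μ).contDiffOn.exists_lipschitzOnWith one_ne_zero
    ((convex_Icc 0 N).prod ((convex_Icc 0 N).prod (convex_closedBall 0 R)))
    (isCompact_Icc.prod (isCompact_Icc.prod (isCompact_closedBall 0 R)))
  refine ⟨K, fun t ht => LipschitzOnWith.of_dist_le_mul fun X hX Y hY => ?_⟩
  have hmem {Z : Matrix (Fin 2) (Fin 2) ℝ} (hZ : Z ∈ closedBall 0 R) :
      (ψ t, (ψ t)⁻¹, Z) ∈ Icc 0 N ×ˢ Icc 0 N ×ˢ closedBall 0 R :=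
    ⟨⟨(hpos t ht).le, (hN t ht).1⟩, ⟨(inv_pos.2 (hpos t ht)).le, (hN t ht).2⟩, hZ⟩
  simpa [riccatiField, Prod.dist_eq] using hK.dist_le_mul _ (hmem hX) _ (hmem hY)

lemma riccatiField_continuousOn (hψ : ContinuousOn ψ (Icc 0 T))
    (hpos : ∀ t ∈ Icc 0 T, 0 < ψ t) (X : Matrix (Fin 2) (Fin 2) ℝ) :
    ContinuousOn (riccatiField ψ ϑ μ · X) (Icc 0 T) :=
  (contDiff_smul_Fric ϑ μ).continuous.comp_continuousOn
    (hψ.prodMk ((continuousOn_inv_of_pos hψ hpos).prodMk continuousOn_const))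

lemma hasDerivWithinAt_matrix_iff {m n : Type*} [Fintype m] [Fintype n] {X : ℝ → Matrix m n ℝ}
    {X' : Matrix m n ℝ} {s : Set ℝ} {t : ℝ} :
    HasDerivWithinAt X X' s t ↔
      ∀ i j, HasDerivWithinAt (fun t => X t i j) (X' i j) s t :=
  hasDerivWithinAt_pi.trans (forall_congr' fun _ => hasDerivWithinAt_pi)

variable {X : ℝ → Matrix (Fin 2) (Fin 2) ℝ}

/-- Solutions of the Riccati equation starting from `0` are symmetric. -/
lemma riccati_transpose_eq (hψ : ContinuousOn ψ (Icc 0 T)) (hpos : ∀ t ∈ Icc 0 T, 0 < ψ t)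
    (hX0 : X 0 = 0) (hX : IsIntegralCurveOn X (riccatiField ψ ϑ μ) (Icc 0 T)) :
    ∀ t ∈ Icc 0 T, (X t)ᵀ = X t := by
  have hXt : IsIntegralCurveOn (fun t => (X t)ᵀ) (riccatiField ψ ϑ μ) (Icc 0 T) := by
    intro t ht
    refine hasDerivWithinAt_matrix_iff.2 fun i j => ?_
    rw [riccatiField, Fric_transpose]
    exact hasDerivWithinAt_matrix_iff.1 (hX t ht) j i
  exact hXt.eqOn_Icc_of_lipschitzOnWith_closedBall (riccatiField_lipschitzOnWith hψ hpos) hX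
    (by simp [hX0])

/-- The coefficient `-(ϑ/2) Aᵀ - (μ²/8) ℓ ℓᵀ X` of the linear equation dual to the Riccati
equation written in Lyapunov form. -/
noncomputable def dualCoeff (ϑ μ p : ℝ) (X : Matrix (Fin 2) (Fin 2) ℝ) :
    Matrix (Fin 2) (Fin 2) ℝ :=
  (-(ϑ / 2)) • (Amat p)ᵀ - (μ ^ 2 / 8) • (vecMulVec (lVec p) (lVec p) * X)

lemma dualCoeff_mulVec_apply (p : ℝ) (Y : Matrix (Fin 2) (Fin 2) ℝ) (w : Fin 2 → ℝ) (i : Fin 2) :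
    (dualCoeff ϑ μ p Y *ᵥ w) i =
      lVec p i * (-(ϑ / 2) * (w 0 + p * w 1)
        - μ ^ 2 / 8 * ((p * Y 0 0 + Y 1 0) * w 0 + (p * Y 0 1 + Y 1 1) * w 1)) := by
  fin_cases i <;>
    simp [dualCoeff, Amat, bVec, lVec, Matrix.mul_apply, Matrix.mulVec,
      dotProduct, Fin.sum_univ_two] <;> ring

lemma continuous_dualCoeff :
    Continuous fun z : ℝ × Matrix (Fin 2) (Fin 2) ℝ => dualCoeff ϑ μ z.1 z.2 := by
  have hb : Continuous fun z : ℝ × Matrix (Fin 2) (Fin 2) ℝ => bVec z.1 := by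
    unfold bVec; fun_prop
  have hl : Continuous fun z : ℝ × Matrix (Fin 2) (Fin 2) ℝ => lVec z.1 := by
    unfold lVec; fun_prop
  unfold dualCoeff Amat
  exact ((hb.matrix_vecMulVec hl).matrix_transpose.const_smul (-(ϑ / 2))).sub
    (((hl.matrix_vecMulVec hl).matrix_mul continuous_snd).const_smul (μ ^ 2 / 8))

/-- The quadratic form of a solution of the Riccati equation starting from `0` is nonnegative. -/
lemma riccati_quadratic_nonneg (hT : 0 ≤ T) (hψ : ContinuousOn ψ (Icc 0 T))
    (hpos : ∀ t ∈ Icc 0 T, 0 < ψ t) (hX0 : X 0 = 0)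
    (hX : IsIntegralCurveOn X (riccatiField ψ ϑ μ) (Icc 0 T)) (v : Fin 2 → ℝ) :
    0 ≤ v 0 ^ 2 * X T 0 0 + 2 * (v 0 * v 1) * X T 0 1 + v 1 ^ 2 * X T 1 1 := by
  have hsymm (t : ℝ) (ht : t ∈ Icc 0 T) : X t 1 0 = X t 0 1 :=
    congrFun₂ (riccati_transpose_eq hψ hpos hX0 hX t ht) 0 1
  have hmaps : MapsTo (fun s => T - s) (Icc 0 T) (Icc 0 T) := fun s hs =>
    ⟨sub_nonneg.2 hs.2, sub_le_self T hs.1⟩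
  have hrev : ContinuousOn (fun s => T - s) (Icc 0 T) := by fun_prop
  let toCLM : Matrix (Fin 2) (Fin 2) ℝ →ₗ[ℝ] ((Fin 2 → ℝ) →L[ℝ] (Fin 2 → ℝ)) :=
    LinearMap.toContinuousLinearMap.toLinearMap ∘ₗ (Matrix.toLin' (R := ℝ)).toLinearMap
  let B (s : ℝ) : (Fin 2 → ℝ) →L[ℝ] (Fin 2 → ℝ) :=
    toCLM ((ψ (T - s))⁻¹ • dualCoeff ϑ μ (ψ (T - s)) (X (T - s)))
  have hB : ContinuousOn B (Icc 0 T) := by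
    have hinv : ContinuousOn (fun s => (ψ (T - s))⁻¹) (Icc 0 T) :=
      (continuousOn_inv_of_pos hψ hpos).comp hrev hmaps
    have hpair : ContinuousOn (fun s => (ψ (T - s), X (T - s))) (Icc 0 T) :=
      (hψ.comp hrev hmaps).prodMk (hX.continuousOn.comp hrev hmaps)
    have hdual : ContinuousOn (fun s => dualCoeff ϑ μ (ψ (T - s)) (X (T - s))) (Icc 0 T) := by
      have hcomp := (continuous_dualCoeff (ϑ := ϑ) (μ := μ)).comp_continuousOn hpair
      exact hcomp
    exact toCLM.continuous_of_finiteDimensional.comp_continuousOn (hinv.fun_smul hdual)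
  obtain ⟨w, hw0, hw⟩ := exists_isIntegralCurveOn_Icc_linear hT hB v
  have hw' (i : Fin 2) (s : ℝ) (hs : s ∈ Icc 0 T) : HasDerivWithinAt (fun s => w s i)
      ((ψ (T - s))⁻¹ * (dualCoeff ϑ μ (ψ (T - s)) (X (T - s)) *ᵥ w s) i) (Icc 0 T) s := by
    have := hasDerivWithinAt_pi.1 (hw s hs) i
    simpa [B, toCLM, Matrix.smul_mulVec] using this
  have hX' (i j : Fin 2) (s : ℝ) (hs : s ∈ Icc 0 T) : HasDerivWithinAt (fun s => X (T - s) i j)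
      (-((ψ (T - s))⁻¹ * Fric (ψ (T - s)) ϑ μ (X (T - s)) i j)) (Icc 0 T) s := by
    have hsub : HasDerivWithinAt (fun s => T - s) (-1) (Icc 0 T) s :=
      ((hasDerivAt_id s).const_sub T).hasDerivWithinAt
    have := (hasDerivWithinAt_matrix_iff.1 (hX (T - s) (hmaps hs)) i j).scomp s hsub hmaps
    simpa [Function.comp_def, riccatiField] using this
  have hderiv (s : ℝ) (hs : s ∈ Icc 0 T) : HasDerivWithinAt
      (fun s => w s 0 ^ 2 * X (T - s) 0 0 + 2 * (w s 0 * w s 1) * X (T - s) 0 1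
        + w s 1 ^ 2 * X (T - s) 1 1)
      (-((ψ (T - s))⁻¹ * (w s 0 + ψ (T - s) * w s 1) ^ 2)) (Icc 0 T) s := by
    refine (((((hw' 0 s hs).pow 2).mul (hX' 0 0 s hs)).add
      ((((hw' 0 s hs).mul (hw' 1 s hs)).const_mul 2).mul (hX' 0 1 s hs))).add
      (((hw' 1 s hs).pow 2).mul (hX' 1 1 s hs))).congr_deriv ?_
    simp only [dualCoeff_mulVec_apply, Fric_apply, hsymm (T - s) (hmaps hs), bVec, lVec,
      cons_val_zero, cons_val_one, Pi.mul_apply, Pi.pow_apply]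
    push_cast
    ring
  have hanti := antitoneOn_of_hasDerivWithinAt_nonpos (convex_Icc 0 T)
    (fun s hs => (hderiv s hs).continuousWithinAt)
    (fun s hs => (hderiv s (interior_subset hs)).mono interior_subset)
    (fun s hs => by
      have := inv_pos.2 (hpos (T - s) (hmaps (interior_subset hs)))
      rw [neg_nonpos]
      positivity)
  simpa [hX0, hw0] using hanti ⟨le_rfl, hT⟩ ⟨hT, le_rfl⟩ hT

lemma riccati_posSemidef (hT : 0 ≤ T) (hψ : ContinuousOn ψ (Icc 0 T))
    (hpos : ∀ t ∈ Icc 0 T, 0 < ψ t) (hX0 : X 0 = 0)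
    (hX : IsIntegralCurveOn X (riccatiField ψ ϑ μ) (Icc 0 T)) : (X T).PosSemidef := by
  have hsymm := riccati_transpose_eq hψ hpos hX0 hX T ⟨hT, le_rfl⟩
  refine .of_dotProduct_mulVec_nonneg ?_ fun v => ?_
  · rwa [Matrix.IsHermitian, conjTranspose_eq_transpose_of_trivial]
  · have hoff : X T 1 0 = X T 0 1 := congrFun₂ hsymm 0 1
    refine (riccati_quadratic_nonneg hT hψ hpos hX0 hX v).trans_eq ?_
    simp only [Matrix.mulVec, dotProduct, Fin.sum_univ_two, hoff, star_trivial]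
    ring

/-- The Riccati equation has an a priori bound: its solutions starting from `0` grow at most
exponentially on `[0, T]`. -/
lemma riccati_norm_le {N : ℝ} (hT : 0 ≤ T) (hψ : ContinuousOn ψ (Icc 0 T))
    (hpos : ∀ t ∈ Icc 0 T, 0 < ψ t) (hN : ∀ t ∈ Icc 0 T, ψ t ≤ N ∧ (ψ t)⁻¹ ≤ N)
    (hX0 : X 0 = 0) (hX : IsIntegralCurveOn X (riccatiField ψ ϑ μ) (Icc 0 T)) :
    ‖X T‖ ≤ Real.exp (|ϑ| * (1 + N) * T) * (2 * N * T) := by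
  have hN0 : 0 ≤ N := (hpos 0 ⟨le_rfl, hT⟩).le.trans (hN 0 ⟨le_rfl, hT⟩).1
  have hquad (t : ℝ) (ht : t ∈ Icc 0 T) (v : Fin 2 → ℝ) :
      0 ≤ v 0 ^ 2 * X t 0 0 + 2 * (v 0 * v 1) * X t 0 1 + v 1 ^ 2 * X t 1 1 :=
    riccati_quadratic_nonneg ht.1 (hψ.mono (Icc_subset_Icc_right ht.2))
      (fun s hs => hpos s ⟨hs.1, hs.2.trans ht.2⟩) hX0 (hX.mono (Icc_subset_Icc_right ht.2)) v
  have hsymm (t : ℝ) (ht : t ∈ Icc 0 T) : X t 1 0 = X t 0 1 :=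
    congrFun₂ (riccati_transpose_eq hψ hpos hX0 hX t ht) 0 1
  have hdiag₀ (t : ℝ) (ht : t ∈ Icc 0 T) : 0 ≤ X t 0 0 := by
    simpa using hquad t ht ![1, 0]
  have hdiag₁ (t : ℝ) (ht : t ∈ Icc 0 T) : 0 ≤ X t 1 1 := by
    simpa using hquad t ht ![0, 1]
  have hoff (t : ℝ) (ht : t ∈ Icc 0 T) : |X t 0 1| ≤ (X t 0 0 + X t 1 1) / 2 := by
    have hadd := hquad t ht ![1, 1]
    have hsub := hquad t ht ![1, -1]
    simp only [cons_val_zero, cons_val_one] at hadd hsub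
    exact abs_le.2 ⟨by linarith, by linarith⟩
  set K : ℝ := |ϑ| * (1 + N) with hK
  have hK0 : 0 ≤ K := by positivity
  have hrate (t : ℝ) (ht : t ∈ Icc 0 T) :
      (ψ t)⁻¹ * Fric (ψ t) ϑ μ (X t) 0 0 + (ψ t)⁻¹ * Fric (ψ t) ϑ μ (X t) 1 1
        ≤ K * (X t 0 0 + X t 1 1) + 2 * N := by
    have hp := hpos t ht
    obtain ⟨hpN, hqN⟩ := hN t ht
    have hb := hoff t ht
    have ha := hdiag₀ t ht
    have hd := hdiag₁ t ht
    have hq := inv_pos.2 hp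
    have hpq : (ψ t)⁻¹ * ψ t = 1 := inv_mul_cancel₀ hp.ne'
    simp only [Fric_apply, hsymm t ht, bVec, cons_val_zero, cons_val_one]
    generalize (ψ t)⁻¹ = q at *
    generalize ψ t = p at *
    generalize X t 0 0 = a at *
    generalize X t 0 1 = b at *
    generalize X t 1 1 = d at *
    have hlin : |a + d + (p + q) * b| ≤ (1 + N) * (a + d) := by
      have h1 : |(p + q) * b| ≤ (2 * N) * ((a + d) / 2) := by
        rw [abs_mul, abs_of_pos (add_pos hp hq)]
        exact mul_le_mul (by linarith) hb (abs_nonneg _) (by linarith)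
      have h2 := abs_add_le (a + d) ((p + q) * b)
      rw [abs_of_nonneg (add_nonneg ha hd)] at h2
      linarith
    have hdrift : -ϑ * (a + d + (p + q) * b) ≤ |ϑ| * ((1 + N) * (a + d)) := by
      refine (le_abs_self _).trans ?_
      rw [abs_mul, abs_neg]
      exact mul_le_mul_of_nonneg_left hlin (abs_nonneg _)
    have hdiss : 0 ≤ q * (μ ^ 2 / 4 * ((p * a + b) ^ 2 + (p * b + d) ^ 2)) := by positivity
    calc _ = -ϑ * ((q * p) * a + (q * p) * d + ((q * p) * p + q) * b)
          + (q + (q * p) * p) - q * (μ ^ 2 / 4 * ((p * a + b) ^ 2 + (p * b + d) ^ 2)) := by ring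
      _ ≤ _ := by
        rw [hpq, hK]
        linarith
  have hderiv (t : ℝ) (ht : t ∈ Icc 0 T) : HasDerivWithinAt
      (fun t => Real.exp (-(K * t)) * (X t 0 0 + X t 1 1) - 2 * N * t)
      (Real.exp (-(K * t)) * ((ψ t)⁻¹ * Fric (ψ t) ϑ μ (X t) 0 0
        + (ψ t)⁻¹ * Fric (ψ t) ϑ μ (X t) 1 1 - K * (X t 0 0 + X t 1 1)) - 2 * N) (Icc 0 T) t := by
    have hentry (i j : Fin 2) := hasDerivWithinAt_matrix_iff.1 (hX t ht) i j
    have hexp : HasDerivAt (fun t => Real.exp (-(K * t))) (Real.exp (-(K * t)) * -(K * 1)) t :=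
      (((hasDerivAt_id t).const_mul K).neg).exp
    refine ((hexp.hasDerivWithinAt.mul ((hentry 0 0).add (hentry 1 1))).sub
      ((hasDerivAt_id t).const_mul (2 * N)).hasDerivWithinAt).congr_deriv ?_
    simp only [riccatiField, Matrix.smul_apply, smul_eq_mul, Pi.add_apply]
    ring
  have hanti := antitoneOn_of_hasDerivWithinAt_nonpos (convex_Icc 0 T)
    (fun t ht => (hderiv t ht).continuousWithinAt)
    (fun t ht => (hderiv t (interior_subset ht)).mono interior_subset)
    (fun t ht => by
      have htT := interior_subset ht
      have hexp : Real.exp (-(K * t)) ≤ 1 :=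
        Real.exp_le_one_iff.2 (neg_nonpos.2 (mul_nonneg hK0 htT.1))
      have h1 : Real.exp (-(K * t)) * ((ψ t)⁻¹ * Fric (ψ t) ϑ μ (X t) 0 0
          + (ψ t)⁻¹ * Fric (ψ t) ϑ μ (X t) 1 1 - K * (X t 0 0 + X t 1 1))
          ≤ Real.exp (-(K * t)) * (2 * N) :=
        mul_le_mul_of_nonneg_left (by linarith [hrate t htT]) (Real.exp_pos _).le
      have h2 : Real.exp (-(K * t)) * (2 * N) ≤ 1 * (2 * N) :=
        mul_le_mul_of_nonneg_right hexp (by linarith)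
      linarith)
  have htrace : X T 0 0 + X T 1 1 ≤ Real.exp (K * T) * (2 * N * T) := by
    have h := hanti ⟨le_rfl, hT⟩ ⟨hT, le_rfl⟩ hT
    simp only [hX0, Matrix.zero_apply, add_zero, mul_zero, sub_zero, sub_nonpos,
      Real.exp_neg] at h
    rwa [inv_mul_le_iff₀ (Real.exp_pos _)] at h
  have hTmem : T ∈ Icc 0 T := ⟨hT, le_rfl⟩
  have ha := hdiag₀ T hTmem
  have hd := hdiag₁ T hTmem
  have hb := hoff T hTmem
  have hs := hsymm T hTmem
  refine ((Matrix.norm_le_iff (add_nonneg ha hd)).2 fun i j => ?_).trans htrace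
  rw [Real.norm_eq_abs]
  fin_cases i <;> fin_cases j <;> simp only [Fin.zero_eta, Fin.mk_one, hs]
  · rw [abs_of_nonneg ha]; linarith
  · linarith
  · linarith
  · rw [abs_of_nonneg hd]; linarith

lemma exists_riccati_Icc (hT : 0 ≤ T) (hψ : ContinuousOn ψ (Icc 0 T))
    (hpos : ∀ t ∈ Icc 0 T, 0 < ψ t) :
    ∃ X : ℝ → Matrix (Fin 2) (Fin 2) ℝ, X 0 = 0 ∧
      IsIntegralCurveOn X (riccatiField ψ ϑ μ) (Icc 0 T) := by
  obtain ⟨N, hN0, hN⟩ := exists_bound_self_inv hψ hpos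
  refine exists_isIntegralCurveOn_Icc_of_apriori_bound hT (riccatiField_lipschitzOnWith hψ hpos)
    (riccatiField_continuousOn hψ hpos) 0 (Real.exp (|ϑ| * (1 + N) * T) * (2 * N * T))
    fun τ hτ X hX0 hX => ?_
  have hsub : Icc 0 τ ⊆ Icc 0 T := Icc_subset_Icc_right hτ.2
  refine (riccati_norm_le hτ.1 (hψ.mono hsub) (fun t ht => hpos t (hsub ht))
    (fun t ht => hN t (hsub ht)) hX0 hX).trans ?_
  have hτ0 := hτ.1
  have hτT := hτ.2
  gcongr

end Riccati

/-- For continuous `ψ : [0,∞) → (0,∞)`, the Riccati initial value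
problem `Γ' = ψ⁻¹ F_ψ(Γ)`, `Γ(0) = 0`, has a solution on `[0,∞)` which is symmetric
positive semidefinite for every `t ≥ 0` (no finite-time blow-up), and the solution is
unique. -/
theorem riccati_ivp_global_wellposed (ϑ μ : ℝ) (ψ : ℝ → ℝ)
    (hψ_cont : ContinuousOn ψ (Ici 0))
    (hψ_pos : ∀ t ∈ Ici (0 : ℝ), 0 < ψ t) :
    (∃ Γ : ℝ → Matrix (Fin 2) (Fin 2) ℝ,
      (Γ 0 = 0 ∧ ∀ t ∈ Ici (0 : ℝ),
        HasDerivWithinAt Γ ((ψ t)⁻¹ • Fric (ψ t) ϑ μ (Γ t)) (Ici 0) t) ∧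
      ∀ t ∈ Ici (0 : ℝ), (Γ t).PosSemidef) ∧
    (∀ Γ₁ Γ₂ : ℝ → Matrix (Fin 2) (Fin 2) ℝ,
      (Γ₁ 0 = 0 ∧ ∀ t ∈ Ici (0 : ℝ),
        HasDerivWithinAt Γ₁ ((ψ t)⁻¹ • Fric (ψ t) ϑ μ (Γ₁ t)) (Ici 0) t) →
      (Γ₂ 0 = 0 ∧ ∀ t ∈ Ici (0 : ℝ),
        HasDerivWithinAt Γ₂ ((ψ t)⁻¹ • Fric (ψ t) ϑ μ (Γ₂ t)) (Ici 0) t) →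
      ∀ t ∈ Ici (0 : ℝ), Γ₁ t = Γ₂ t) := by
  have hcont (T : ℝ) : ContinuousOn ψ (Icc 0 T) := hψ_cont.mono Icc_subset_Ici_self
  have hpos (T : ℝ) (t : ℝ) (ht : t ∈ Icc 0 T) : 0 < ψ t := hψ_pos t ht.1
  have hunique {T : ℝ} {X Y : ℝ → Matrix (Fin 2) (Fin 2) ℝ} (hX0 : X 0 = 0) (hY0 : Y 0 = 0)
      (hX : IsIntegralCurveOn X (riccatiField ψ ϑ μ) (Icc 0 T))
      (hY : IsIntegralCurveOn Y (riccatiField ψ ϑ μ) (Icc 0 T)) : EqOn X Y (Icc 0 T) :=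
    hX.eqOn_Icc_of_lipschitzOnWith_closedBall
      (riccatiField_lipschitzOnWith (hcont T) (hpos T)) hY (hX0.trans hY0.symm)
  refine ⟨?_, fun Γ₁ Γ₂ ⟨h₁0, h₁⟩ ⟨h₂0, h₂⟩ t ht => ?_⟩
  · have hex (T : ℝ) : ∃ X : ℝ → Matrix (Fin 2) (Fin 2) ℝ, X 0 = 0 ∧
        (0 ≤ T → IsIntegralCurveOn X (riccatiField ψ ϑ μ) (Icc 0 T)) := by
      by_cases hT : 0 ≤ T
      · obtain ⟨X, hX0, hX⟩ := exists_riccati_Icc (ϑ := ϑ) (μ := μ) hT (hcont T) (hpos T)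
        exact ⟨X, hX0, fun _ => hX⟩
      · exact ⟨0, rfl, fun h => absurd h hT⟩
    choose X hX0 hX using hex
    have hglue {T t : ℝ} (ht : t ∈ Icc 0 T) : X (t + 1) t = X T t :=
      hunique (hX0 _) (hX0 _)
        ((hX (t + 1) (by linarith [ht.1])).mono (Icc_subset_Icc_right (by linarith)))
        ((hX T (ht.1.trans ht.2)).mono (Icc_subset_Icc_right ht.2)) ⟨ht.1, le_rfl⟩
    refine ⟨fun t => X (t + 1) t, ⟨hX0 _, fun t ht => ?_⟩, fun t ht => ?_⟩
    · have ht0 : (0 : ℝ) ≤ t := ht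
      have hmem : t ∈ Icc 0 (t + 1) := ⟨ht0, by linarith⟩
      have hnhds : Icc 0 (t + 1) ∈ nhdsWithin t (Ici 0) := by
        rw [← Ici_inter_Iic]
        exact inter_mem_nhdsWithin _ (Iic_mem_nhds (lt_add_one t))
      exact (((hX (t + 1) (by linarith)) t hmem).congr (fun s hs => hglue hs)
        rfl).mono_of_mem_nhdsWithin hnhds
    · have ht0 : (0 : ℝ) ≤ t := ht
      exact riccati_posSemidef ht0 (hcont t) (hpos t) (hX0 _)
        ((hX (t + 1) (by linarith)).mono (Icc_subset_Icc_right (by linarith)))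
  · exact hunique h₁0 h₂0 (fun s hs => (h₁ s hs.1).mono Icc_subset_Ici_self)
      (fun s hs => (h₂ s hs.1).mono Icc_subset_Ici_self) ⟨ht, le_rfl⟩
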